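/- Let K ≥ 1, T ≥ 1, η > 0, δ > 0 with δη ≤ 1, and c_0 ∈ [0,1]. Let r_t, c_t ∈ [0,1]^K (t = 1,…,T) be arbitrary reward and constraint vectors. Run the LEWA updates: w_1 = (1,…,1), λ_1 = 0, p_t = w_t/(Σ_j w_{t,j}), w_{t+1,i} = w_{t,i}·exp(η(r_{t,i} + λ_t c_{t,i})), λ_{t+1} = [(1 − δη)λ_t − η(p_t·c_t − c_0)]_+. Then for every probability vector p ∈ Δ_K and every λ ≥ 0: Σ_{t=1}^T (p·r_t − p_t·r_t) + λ·Σ_{t=1}^T (c_0 − p_t·c_t) − (δT/2 + 1/(2η))·λ² ≤ (ln K)/η + (9/4)ηT + (η/4 − δ/2)·Σ_{t=1}^T λ_t² + Σ_{t=1}^T λ_t(c_0 − p·c_t). -/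

import Mathlib

open MeasureTheory ProbabilityTheory in
/-- **Hoeffding's lemma** for a finitely supported probability distribution. -/
theorem sum_mul_exp_le_of_mem_Icc {ι : Type*} [Fintype ι] (p X : ι → ℝ) (hp : ∀ i, 0 ≤ p i)
    (hp1 : ∑ i, p i = 1) {a b : ℝ} (hX : ∀ i, X i ∈ Set.Icc a b) (t : ℝ) :
    ∑ i, p i * Real.exp (t * X i)
      ≤ Real.exp (t * ∑ i, p i * X i + t ^ 2 * (b - a) ^ 2 / 8) := by
  let _ : MeasurableSpace ι := ⊤
  have hsum : ∑ i, ENNReal.ofReal (p i) = 1 := by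
    rw [← ENNReal.ofReal_sum_of_nonneg fun i _ => hp i, hp1, ENNReal.ofReal_one]
  set P : PMF ι := PMF.ofFintype _ hsum
  have hint (f : ι → ℝ) : ∫ i, f i ∂P.toMeasure = ∑ i, p i * f i := by
    simp [PMF.integral_eq_sum, P, ENNReal.toReal_ofReal (hp _)]
  have hm := (hasSubgaussianMGF_of_mem_Icc (μ := P.toMeasure)
    (measurable_of_finite X).aemeasurable (.of_forall hX)).mgf_le t
  rw [mgf, hint, hint] at hm
  calc ∑ i, p i * Real.exp (t * X i)
      = Real.exp (t * ∑ i, p i * X i)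
          * ∑ i, p i * Real.exp (t * (X i - ∑ j, p j * X j)) := by
        rw [Finset.mul_sum]
        refine Finset.sum_congr rfl fun i _ => ?_
        rw [mul_left_comm, ← Real.exp_add]
        ring_nf
    _ ≤ _ := mul_le_mul_of_nonneg_left hm (Real.exp_pos _).le
    _ = _ := by
        rw [← Real.exp_add]
        congr 2
        simp only [NNReal.coe_pow, NNReal.coe_div, coe_nnnorm, Real.norm_eq_abs, div_pow, sq_abs,
          NNReal.coe_ofNat]
        ring

/-- One round of exponential weights increases the log-partition function by at most the average
gain plus a quadratic term. -/
theorem log_sum_mul_exp_le {ι : Type*} [Fintype ι] [Nonempty ι] (w g : ι → ℝ)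
    (hw : ∀ i, 0 < w i) {b : ℝ} (hg : ∀ i, g i ∈ Set.Icc 0 b) (η : ℝ) :
    Real.log (∑ i, w i * Real.exp (η * g i))
      ≤ Real.log (∑ i, w i) + η * ∑ i, w i / (∑ j, w j) * g i + η ^ 2 * b ^ 2 / 8 := by
  have hW : 0 < ∑ i, w i := Finset.sum_pos (fun i _ => hw i) Finset.univ_nonempty
  have hpos : 0 < ∑ i, w i * Real.exp (η * g i) :=
    Finset.sum_pos (fun i _ => mul_pos (hw i) (Real.exp_pos _)) Finset.univ_nonempty
  have h := sum_mul_exp_le_of_mem_Icc (fun i => w i / ∑ j, w j) g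
    (fun i => (div_pos (hw i) hW).le) (by rw [← Finset.sum_div, div_self hW.ne']) hg η
  simp only [div_mul_eq_mul_div, ← Finset.sum_div] at h ⊢
  rw [← Real.log_le_iff_le_exp (div_pos hpos hW), Real.log_div hpos.ne' hW.ne', sub_zero] at h
  linarith

/-- A weighted average of logarithms is at most the logarithm of the sum. -/
theorem sum_mul_log_le_log_sum {ι : Type*} [Fintype ι] (q w : ι → ℝ) (hq : ∀ i, 0 ≤ q i)
    (hq1 : ∑ i, q i = 1) (hw : ∀ i, 0 < w i) :
    ∑ i, q i * Real.log (w i) ≤ Real.log (∑ i, w i) :=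
  calc ∑ i, q i * Real.log (w i) ≤ ∑ i, q i * Real.log (∑ j, w j) :=
        Finset.sum_le_sum fun i hi => mul_le_mul_of_nonneg_left
          (Real.log_le_log (hw i) (Finset.single_le_sum (fun j _ => (hw j).le) hi)) (hq i)
    _ = Real.log (∑ i, w i) := by rw [← Finset.sum_mul, hq1, one_mul]

/-- A weighted average of numbers in an interval lies in that interval. -/
theorem sum_mul_mem_Icc {ι : Type*} [Fintype ι] (p x : ι → ℝ) (hp : ∀ i, 0 ≤ p i)
    (hp1 : ∑ i, p i = 1) {a b : ℝ} (hx : ∀ i, x i ∈ Set.Icc a b) :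
    ∑ i, p i * x i ∈ Set.Icc a b :=
  (convex_Icc a b).sum_mem (fun i _ => hp i) hp1 fun i _ => hx i

/-- One step of projected gradient descent for the regularized dual objective, started from a
multiplier in `[0, 1 / δ]`, with constraint violation `d` in `[-1, 1]`. -/
theorem dual_step_le {η δ l d u : ℝ} (hη : 0 < η) (hδ : 0 < δ) (hl : 0 ≤ l) (hδl : δ * l ≤ 1)
    (hd : |d| ≤ 1) (hu : 0 ≤ u) :
    l * d - u * d + δ / 2 * l ^ 2 - δ / 2 * u ^ 2
      ≤ 2 * η + ((l - u) ^ 2 - (max 0 ((1 - δ * η) * l - η * d) - u) ^ 2) / (2 * η) := by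
  obtain ⟨hd1, hd2⟩ := abs_le.mp hd
  have hproj : (max 0 ((1 - δ * η) * l - η * d) - u) ^ 2
      ≤ ((1 - δ * η) * l - η * d - u) ^ 2 := by
    rcases le_total 0 ((1 - δ * η) * l - η * d) with h | h
    · rw [max_eq_right h]
    · rw [max_eq_left h]
      nlinarith
  have hgrad : (δ * l + d) ^ 2 ≤ 4 := by
    have : 0 ≤ δ * l := by positivity
    nlinarith
  have hconv : 0 ≤ δ * (l - u) ^ 2 := by positivity
  rw [← sub_le_iff_le_add', le_div_iff₀ (by positivity)]
  nlinarith [mul_le_mul_of_nonneg_left hgrad (sq_nonneg η), mul_nonneg hη.le hconv]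


/-- Deterministic combined primal–dual inequality for the LEWA algorithm.
Rounds `t = 1, …, T` are indexed by `t = 0, …, T-1`. -/
theorem lewa_primal_dual_inequality (K T : ℕ) (hK : 1 ≤ K) (hT : 1 ≤ T)
    (η δ c0 : ℝ) (hη : 0 < η) (hδ : 0 < δ) (hδη : δ * η ≤ 1)
    (hc0 : c0 ∈ Set.Icc (0 : ℝ) 1)
    (r c : ℕ → Fin K → ℝ)
    (hr : ∀ t < T, ∀ i, r t i ∈ Set.Icc (0 : ℝ) 1)
    (hc : ∀ t < T, ∀ i, c t i ∈ Set.Icc (0 : ℝ) 1)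
    (w : ℕ → Fin K → ℝ) (lam : ℕ → ℝ) (p : ℕ → Fin K → ℝ)
    (hw0 : ∀ i, w 0 i = 1) (hlam0 : lam 0 = 0)
    (hp : ∀ t < T, ∀ i, p t i = w t i / ∑ j, w t j)
    (hwrec : ∀ t < T, ∀ i,
      w (t + 1) i = w t i * Real.exp (η * (r t i + lam t * c t i)))
    (hlamrec : ∀ t < T,
      lam (t + 1) = max 0 ((1 - δ * η) * lam t - η * ((∑ i, p t i * c t i) - c0)))
    (q : Fin K → ℝ) (hq : ∀ i, 0 ≤ q i) (hq1 : ∑ i, q i = 1)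
    (lamb : ℝ) (hlamb : 0 ≤ lamb) :
    ∑ t ∈ Finset.range T, ((∑ i, q i * r t i) - ∑ i, p t i * r t i)
      + lamb * ∑ t ∈ Finset.range T, (c0 - ∑ i, p t i * c t i)
      - (δ * T / 2 + 1 / (2 * η)) * lamb ^ 2
      ≤ Real.log K / η + 9 / 4 * η * T
        + (η / 4 - δ / 2) * ∑ t ∈ Finset.range T, lam t ^ 2
        + ∑ t ∈ Finset.range T, lam t * (c0 - ∑ i, q i * c t i) := by
  have : NeZero K := ⟨by omega⟩
  have hw : ∀ t ≤ T, ∀ i, 0 < w t i := by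
    intro t
    induction t with
    | zero => simp [hw0]
    | succ t ih =>
      intro ht i
      rw [hwrec t ht]
      exact mul_pos (ih (by omega) i) (Real.exp_pos _)
  have hW : ∀ t ≤ T, 0 < ∑ i, w t i := fun t ht =>
    Finset.sum_pos (fun i _ => hw t ht i) Finset.univ_nonempty
  have hp_nonneg : ∀ t < T, ∀ i, 0 ≤ p t i := fun t ht i => by
    rw [hp t ht]
    exact (div_pos (hw t ht.le i) (hW t ht.le)).le
  have hp_sum : ∀ t < T, ∑ i, p t i = 1 := fun t ht => by
    simp only [hp t ht, ← Finset.sum_div, div_self (hW t ht.le).ne']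
  have hviol : ∀ t < T, |(∑ i, p t i * c t i) - c0| ≤ 1 := fun t ht => by
    obtain ⟨h0, h1⟩ := sum_mul_mem_Icc (p t) (c t) (hp_nonneg t ht) (hp_sum t ht) (hc t ht)
    exact abs_le.mpr ⟨by linarith [hc0.2], by linarith [hc0.1]⟩
  have hlam : ∀ t ≤ T, 0 ≤ lam t ∧ δ * lam t ≤ 1 := by
    intro t
    induction t with
    | zero => simp [hlam0]
    | succ t ih =>
      intro ht
      obtain ⟨-, ih1⟩ := ih (by omega)
      rw [hlamrec t ht, mul_max_of_nonneg _ _ hδ.le]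
      refine ⟨le_max_left _ _, max_le (by simp) ?_⟩
      have h := (abs_le.mp (hviol t ht)).1
      nlinarith [mul_pos hδ hη, mul_nonneg (sub_nonneg.mpr hδη) (sub_nonneg.mpr ih1)]
  let Φ : ℕ → ℝ := fun t =>
    (lam t - lamb) ^ 2 / (2 * η) + (Real.log (∑ i, w t i) - ∑ i, q i * Real.log (w t i)) / η
  have hround : ∀ t < T,
      ((∑ i, q i * r t i) - ∑ i, p t i * r t i) + lamb * (c0 - ∑ i, p t i * c t i)
        - δ / 2 * lamb ^ 2
      ≤ 9 / 4 * η + (η / 4 - δ / 2) * lam t ^ 2 + lam t * (c0 - ∑ i, q i * c t i)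
        + (Φ t - Φ (t + 1)) := by
    intro t ht
    obtain ⟨hl, hδl⟩ := hlam t ht.le
    have hdual := dual_step_le hη hδ hl hδl (hviol t ht) hlamb
    rw [← hlamrec t ht] at hdual
    have hprimal := log_sum_mul_exp_le (w t) (fun i => r t i + lam t * c t i) (hw t ht.le)
      (b := 1 + lam t)
      (fun i => ⟨add_nonneg (hr t ht i).1 (mul_nonneg hl (hc t ht i).1),
        add_le_add (hr t ht i).2 (mul_le_of_le_one_right hl (hc t ht i).2)⟩) η
    simp only [← hp t ht, ← hwrec t ht] at hprimal
    have hlin (x : Fin K → ℝ) : ∑ i, x i * (r t i + lam t * c t i)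
        = ∑ i, x i * r t i + lam t * ∑ i, x i * c t i := by
      rw [Finset.mul_sum, ← Finset.sum_add_distrib]
      exact Finset.sum_congr rfl fun i _ => by ring
    have hlog : ∑ i, q i * Real.log (w (t + 1) i) = ∑ i, q i * Real.log (w t i)
        + η * ∑ i, q i * (r t i + lam t * c t i) := by
      rw [Finset.mul_sum, ← Finset.sum_add_distrib]
      refine Finset.sum_congr rfl fun i _ => ?_
      rw [hwrec t ht, Real.log_mul (hw t ht.le i).ne' (Real.exp_pos _).ne', Real.log_exp]
      ring
    rw [hlin] at hprimal hlog
    have hregret : (∑ i, q i * r t i + lam t * ∑ i, q i * c t i)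
        - (∑ i, p t i * r t i + lam t * ∑ i, p t i * c t i)
        ≤ η / 4 * (1 + lam t ^ 2)
          + ((Real.log (∑ i, w t i) - ∑ i, q i * Real.log (w t i))
            - (Real.log (∑ i, w (t + 1) i) - ∑ i, q i * Real.log (w (t + 1) i))) / η := by
      rw [← sub_le_iff_le_add', le_div_iff₀ hη, hlog]
      nlinarith [mul_nonneg (sq_nonneg η) (sq_nonneg (1 - lam t))]
    simp only [Φ]
    rw [sub_div] at hdual hregret
    linarith
  have hΦ0 : Φ 0 = 1 / (2 * η) * lamb ^ 2 + Real.log K / η := by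
    simp [Φ, hlam0, hw0]
    ring
  have hΦT : 0 ≤ Φ T := add_nonneg (by positivity)
    (div_nonneg (sub_nonneg.mpr (sum_mul_log_le_log_sum q (w T) hq hq1 (hw T le_rfl))) hη.le)
  have htotal := Finset.sum_le_sum fun t ht => hround t (Finset.mem_range.mp ht)
  rw [Finset.sum_sub_distrib, Finset.sum_add_distrib, Finset.sum_add_distrib,
    Finset.sum_add_distrib, Finset.sum_add_distrib, Finset.sum_range_sub'] at htotal
  simp only [Finset.sum_const, ← Finset.mul_sum, Finset.card_range, nsmul_eq_mul] at htotal
  linarith
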